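/- Fix natural numbers p and q. Let R be the quotient of the polynomial ring ℂ[w_i, w_j, y_i, y_j, y_{ji}, z_i, z_j, z_{ji}] by the ideal generated by the nine elements: z_j z_i − (w_i−w_j) z_{ji}, y_j y_i − (w_i−w_j) y_{ji}, z_{ji} y_{ji} − w_i^p w_j^q, z_i y_i − (w_i−w_j) w_i^p, z_j y_j − (w_i−w_j) w_j^q, z_i y_{ji} − w_i^p y_j, z_j y_{ji} − w_j^q y_i, y_i z_{ji} − w_i^p z_j, y_j z_{ji} − w_j^q z_i. Let T be the quotient of ℂ[w_i, w_j, y_i, y_j, z_i, z_j] by the ideal generated by the two elements z_i y_i − (w_i−w_j) w_i^p and z_j y_j − (w_i−w_j) w_j^q. Then the localization of R at the element (w_i − w_j) is isomorphic as a ℂ-algebra to the localization of T at the element (w_i − w_j), via the map fixing w_i, w_j, y_i, y_j, z_i, z_j and sending y_{ji} ↦ (w_i−w_j)^{−1} y_j y_i and z_{ji} ↦ (w_i−w_j)^{−1} z_j z_i. (This identifies the local model of the Coulomb branch 𝓜₀ over the locus w_i ≠ w_j with an open subset in the product of Kleinian singularities of types A_{q−1} and A_{p−1}, as in Section 'Computation'.)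 -/

import Mathlib

open MvPolynomial

set_option synthInstance.maxHeartbeats 1000000
set_option maxHeartbeats 1000000

noncomputable section

/-- Variables: `0 = wᵢ`, `1 = wⱼ`, `2 = yᵢ`, `3 = yⱼ`, `4 = yⱼᵢ`, `5 = zᵢ`,
`6 = zⱼ`, `7 = zⱼᵢ`.  The nine defining relations of the local model `R`. -/
def bowRels (p q : ℕ) : Set (MvPolynomial (Fin 8) ℂ) :=
  { X 6 * X 5 - (X 0 - X 1) * X 7,
    X 3 * X 2 - (X 0 - X 1) * X 4,
    X 7 * X 4 - X 0 ^ p * X 1 ^ q,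
    X 5 * X 2 - (X 0 - X 1) * X 0 ^ p,
    X 6 * X 3 - (X 0 - X 1) * X 1 ^ q,
    X 5 * X 4 - X 0 ^ p * X 3,
    X 6 * X 4 - X 1 ^ q * X 2,
    X 2 * X 7 - X 0 ^ p * X 6,
    X 3 * X 7 - X 1 ^ q * X 5 }

/-- `R = ℂ[wᵢ, wⱼ, yᵢ, yⱼ, yⱼᵢ, zᵢ, zⱼ, zⱼᵢ]/(nine relations)`. -/
abbrev BowR (p q : ℕ) : Type :=
  MvPolynomial (Fin 8) ℂ ⧸ Ideal.span (bowRels p q)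

/-- The class in `R` of a polynomial. -/
def bowMk (p q : ℕ) (a : MvPolynomial (Fin 8) ℂ) : BowR p q :=
  Ideal.Quotient.mk (Ideal.span (bowRels p q)) a

/-- The two relations `zᵢ yᵢ − (wᵢ−wⱼ) wᵢᵖ` and `zⱼ yⱼ − (wᵢ−wⱼ) wⱼ^q`
defining `T`.  Variables: `0 = wᵢ`, `1 = wⱼ`, `2 = yᵢ`, `3 = yⱼ`, `4 = zᵢ`,
`5 = zⱼ`. -/
def tRels (p q : ℕ) : Set (MvPolynomial (Fin 6) ℂ) :=
  { X 4 * X 2 - (X 0 - X 1) * X 0 ^ p,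
    X 5 * X 3 - (X 0 - X 1) * X 1 ^ q }

/-- `T = ℂ[wᵢ, wⱼ, yᵢ, yⱼ, zᵢ, zⱼ]/(zᵢ yᵢ − (wᵢ−wⱼ) wᵢᵖ, zⱼ yⱼ − (wᵢ−wⱼ) wⱼ^q)`. -/
abbrev BowT (p q : ℕ) : Type :=
  MvPolynomial (Fin 6) ℂ ⧸ Ideal.span (tRels p q)

/-- The class in `T` of a polynomial. -/
def tMk (p q : ℕ) (a : MvPolynomial (Fin 6) ℂ) : BowT p q :=
  Ideal.Quotient.mk (Ideal.span (tRels p q)) a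

/-- The composite `ℂ[w,…] → R → R[(wᵢ−wⱼ)⁻¹]`. -/
def toLocR (p q : ℕ) :
    MvPolynomial (Fin 8) ℂ →+* Localization.Away (bowMk p q (X 0 - X 1)) :=
  (algebraMap (BowR p q) (Localization.Away (bowMk p q (X 0 - X 1)))).comp
    (Ideal.Quotient.mk (Ideal.span (bowRels p q)))

/-- The composite `ℂ[wᵢ,wⱼ,yᵢ,yⱼ,zᵢ,zⱼ] → T → T[(wᵢ−wⱼ)⁻¹]`. -/
def toLocT (p q : ℕ) :
    MvPolynomial (Fin 6) ℂ →+* Localization.Away (tMk p q (X 0 - X 1)) :=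
  (algebraMap (BowT p q) (Localization.Away (tMk p q (X 0 - X 1)))).comp
    (Ideal.Quotient.mk (Ideal.span (tRels p q)))

theorem liftGen {A S : Type} [CommRing A] [CommRing S] (s : Set A) (a : A)
    (b : A ⧸ Ideal.span s) (hb : b = Ideal.Quotient.mk (Ideal.span s) a)
    (f : A →+* S) (hf : ∀ r ∈ s, f r = 0) (hu : IsUnit (f a)) :
    ∃ g : Localization.Away b →+* S, ∀ x,
      g (algebraMap (A ⧸ Ideal.span s) (Localization.Away b)
        (Ideal.Quotient.mk (Ideal.span s) x)) = f x := by
  have hI : ∀ r ∈ Ideal.span s, f r = 0 := by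
    intro r hr
    have h : Ideal.span s ≤ RingHom.ker f :=
      Ideal.span_le.2 fun r hr => (RingHom.mem_ker).2 (hf r hr)
    exact (RingHom.mem_ker).1 (h hr)
  have hu' : IsUnit ((Ideal.Quotient.lift (Ideal.span s) f hI) b) := by
    rw [hb, Ideal.Quotient.lift_mk]; exact hu
  refine ⟨IsLocalization.Away.lift b hu', fun x => ?_⟩
  rw [IsLocalization.Away.lift_eq, Ideal.Quotient.lift_mk]

theorem extGen {A S : Type} [CommRing A] [CommRing S] (s : Set A)
    (b : A ⧸ Ideal.span s) (g h : Localization.Away b →+* S)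
    (H : ∀ x, g (algebraMap (A ⧸ Ideal.span s) (Localization.Away b)
        (Ideal.Quotient.mk (Ideal.span s) x)) =
        h (algebraMap (A ⧸ Ideal.span s) (Localization.Away b)
        (Ideal.Quotient.mk (Ideal.span s) x))) : g = h := by
  apply IsLocalization.ringHom_ext (Submonoid.powers b)
  apply Ideal.Quotient.ringHom_ext
  ext x
  exact H x

theorem relR (p q : ℕ) (r : MvPolynomial (Fin 8) ℂ) (hr : r ∈ bowRels p q) :
    toLocR p q r = 0 := by
  have : Ideal.Quotient.mk (Ideal.span (bowRels p q)) r = 0 :=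
    Ideal.Quotient.eq_zero_iff_mem.2 (Ideal.subset_span hr)
  rw [toLocR, RingHom.comp_apply, this, map_zero]

theorem relT (p q : ℕ) (r : MvPolynomial (Fin 6) ℂ) (hr : r ∈ tRels p q) :
    toLocT p q r = 0 := by
  have : Ideal.Quotient.mk (Ideal.span (tRels p q)) r = 0 :=
    Ideal.Quotient.eq_zero_iff_mem.2 (Ideal.subset_span hr)
  rw [toLocT, RingHom.comp_apply, this, map_zero]

theorem unitR (p q : ℕ) : IsUnit (toLocR p q (X 0 - X 1)) :=
  IsLocalization.Away.algebraMap_isUnit (S := Localization.Away (bowMk p q (X 0 - X 1)))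
    (bowMk p q (X 0 - X 1))

theorem unitT (p q : ℕ) : IsUnit (toLocT p q (X 0 - X 1)) :=
  IsLocalization.Away.algebraMap_isUnit (S := Localization.Away (tMk p q (X 0 - X 1)))
    (tMk p q (X 0 - X 1))

theorem liftR {S : Type} [CommRing S] (p q : ℕ) (f : MvPolynomial (Fin 8) ℂ →+* S)
    (hf : ∀ r ∈ bowRels p q, f r = 0) (hu : IsUnit (f (X 0 - X 1))) :
    ∃ g : Localization.Away (bowMk p q (X 0 - X 1)) →+* S, ∀ x, g (toLocR p q x) = f x :=
  liftGen (bowRels p q) _ _ rfl f hf hu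

theorem liftT {S : Type} [CommRing S] (p q : ℕ) (f : MvPolynomial (Fin 6) ℂ →+* S)
    (hf : ∀ r ∈ tRels p q, f r = 0) (hu : IsUnit (f (X 0 - X 1))) :
    ∃ g : Localization.Away (tMk p q (X 0 - X 1)) →+* S, ∀ x, g (toLocT p q x) = f x :=
  liftGen (tRels p q) _ _ rfl f hf hu

theorem fwd {S : Type} [CommRing S] (p q : ℕ) (c : ℂ →+* S) (w0 w1 y0 y1 z0 z1 u : S)
    (hu : (w0 - w1) * u = 1) (h1 : z0 * y0 = (w0 - w1) * w0 ^ p)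
    (h2 : z1 * y1 = (w0 - w1) * w1 ^ q) (r : MvPolynomial (Fin 8) ℂ) (hr : r ∈ bowRels p q) :
    eval₂Hom c ![w0, w1, y0, y1, u * (y1 * y0), z0, z1, u * (z1 * z0)] r = 0 := by
  simp only [bowRels, Set.mem_insert_iff, Set.mem_singleton_iff] at hr
  rcases hr with h | h | h | h | h | h | h | h | h <;> subst h <;>
    simp only [map_sub, map_mul, map_pow, coe_eval₂Hom, eval₂_X, eval₂_mul, eval₂_sub, eval₂_pow] <;>
    simp [-mul_eq_mul_left_iff, -mul_eq_mul_right_iff] <;>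
    generalize w0 ^ p = P at * <;> generalize w1 ^ q = Q at *
  · linear_combination (-z1 * z0) * hu
  · linear_combination (-y1 * y0) * hu
  · linear_combination u ^ 2 * z1 * y1 * h1 + u ^ 2 * (w0 - w1) * P * h2 +
      P * Q * ((w0 - w1) * u + 1) * hu
  · linear_combination h1
  · linear_combination h2
  · linear_combination u * y1 * h1 + P * y1 * hu
  · linear_combination u * y0 * h2 + Q * y0 * hu
  · linear_combination u * z1 * h1 + P * z1 * hu
  · linear_combination u * z0 * h2 + Q * z0 * hu

/-- `R[(wᵢ−wⱼ)⁻¹] ≅ T[(wᵢ−wⱼ)⁻¹]` as `ℂ`-algebras, via the map fixing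
`wᵢ, wⱼ, yᵢ, yⱼ, zᵢ, zⱼ` and sending `yⱼᵢ ↦ (wᵢ−wⱼ)⁻¹ yⱼ yᵢ` and
`zⱼᵢ ↦ (wᵢ−wⱼ)⁻¹ zⱼ zᵢ` (note `wᵢ−wⱼ` is invertible in the target, so these
two conditions are expressed after multiplying through by `wᵢ−wⱼ`).
Compatibility with the `ℂ`-algebra structures is the condition on the
constants `C c`. -/
theorem stmt9 (p q : ℕ) :
    ∃ e : Localization.Away (bowMk p q (X 0 - X 1)) ≃+*
          Localization.Away (tMk p q (X 0 - X 1)),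
      (∀ c : ℂ, e (toLocR p q (C c)) = toLocT p q (C c)) ∧
      e (toLocR p q (X 0)) = toLocT p q (X 0) ∧
      e (toLocR p q (X 1)) = toLocT p q (X 1) ∧
      e (toLocR p q (X 2)) = toLocT p q (X 2) ∧
      e (toLocR p q (X 3)) = toLocT p q (X 3) ∧
      e (toLocR p q (X 5)) = toLocT p q (X 4) ∧
      e (toLocR p q (X 6)) = toLocT p q (X 5) ∧
      e (toLocR p q (X 4)) * toLocT p q (X 0 - X 1) = toLocT p q (X 3 * X 2) ∧
      e (toLocR p q (X 7)) * toLocT p q (X 0 - X 1) = toLocT p q (X 5 * X 4) := by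
  obtain ⟨u, hu⟩ := (unitT p q).exists_right_inv
  have hT1 := relT p q (X 4 * X 2 - (X 0 - X 1) * X 0 ^ p) (by simp [tRels])
  have hT2 := relT p q (X 5 * X 3 - (X 0 - X 1) * X 1 ^ q) (by simp [tRels])
  have hR1 := relR p q (X 6 * X 5 - (X 0 - X 1) * X 7) (by simp [bowRels])
  have hR2 := relR p q (X 3 * X 2 - (X 0 - X 1) * X 4) (by simp [bowRels])
  have hR3 := relR p q (X 5 * X 2 - (X 0 - X 1) * X 0 ^ p) (by simp [bowRels])
  have hR4 := relR p q (X 6 * X 3 - (X 0 - X 1) * X 1 ^ q) (by simp [bowRels])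
  have hur := unitR p q
  have hut := unitT p q
  simp only [map_sub, map_mul, map_pow] at hu hT1 hT2 hR1 hR2 hR3 hR4 hur hut
  have key := fwd p q ((toLocT p q).comp C) _ _ _ _ _ _ u hu (sub_eq_zero.1 hT1)
    (sub_eq_zero.1 hT2)
  obtain ⟨g, hg⟩ := liftR p q _ key (by simpa using hut)
  obtain ⟨k, hk⟩ := liftT p q (eval₂Hom ((toLocR p q).comp C)
    ![toLocR p q (X 0), toLocR p q (X 1), toLocR p q (X 2), toLocR p q (X 3),
      toLocR p q (X 5), toLocR p q (X 6)]) (by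
    intro r hr
    simp only [tRels, Set.mem_insert_iff, Set.mem_singleton_iff] at hr
    rcases hr with h | h <;> subst h <;>
      simp only [map_sub, map_mul, map_pow, coe_eval₂Hom, eval₂_X]
    · exact hR3
    · exact hR4) (by simpa using hur)
  have gC : ∀ c, g (toLocR p q (C c)) = toLocT p q (C c) := fun c => by rw [hg]; simp
  have g0 : g (toLocR p q (X 0)) = toLocT p q (X 0) := by rw [hg]; simp
  have g1 : g (toLocR p q (X 1)) = toLocT p q (X 1) := by rw [hg]; simp
  have g2 : g (toLocR p q (X 2)) = toLocT p q (X 2) := by rw [hg]; simp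
  have g3 : g (toLocR p q (X 3)) = toLocT p q (X 3) := by rw [hg]; simp
  have g5 : g (toLocR p q (X 5)) = toLocT p q (X 4) := by rw [hg]; simp
  have g6 : g (toLocR p q (X 6)) = toLocT p q (X 5) := by rw [hg]; simp
  have g4 : g (toLocR p q (X 4)) = u * (toLocT p q (X 3) * toLocT p q (X 2)) := by rw [hg]; simp
  have g7 : g (toLocR p q (X 7)) = u * (toLocT p q (X 5) * toLocT p q (X 4)) := by rw [hg]; simp
  have kC : ∀ c, k (toLocT p q (C c)) = toLocR p q (C c) := fun c => by rw [hk]; simp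
  have k0 : k (toLocT p q (X 0)) = toLocR p q (X 0) := by rw [hk]; simp
  have k1 : k (toLocT p q (X 1)) = toLocR p q (X 1) := by rw [hk]; simp
  have k2 : k (toLocT p q (X 2)) = toLocR p q (X 2) := by rw [hk]; simp
  have k3 : k (toLocT p q (X 3)) = toLocR p q (X 3) := by rw [hk]; simp
  have k4 : k (toLocT p q (X 4)) = toLocR p q (X 5) := by rw [hk]; simp
  have k5 : k (toLocT p q (X 5)) = toLocR p q (X 6) := by rw [hk]; simp
  have ku : (toLocR p q (X 0) - toLocR p q (X 1)) * k u = 1 := by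
    have := congrArg k hu
    rwa [map_mul, map_sub, k0, k1, map_one] at this
  have hkg : k.comp g = RingHom.id _ := by
    apply extGen (bowRels p q)
    have : (k.comp g).comp (toLocR p q) = (RingHom.id _).comp (toLocR p q) := by
      apply MvPolynomial.ringHom_ext
      · intro c
        simp only [RingHom.comp_apply, RingHom.id_apply, gC, kC]
      · intro i
        simp only [RingHom.comp_apply, RingHom.id_apply]
        fin_cases i
        · exact (congrArg k g0).trans k0
        · exact (congrArg k g1).trans k1
        · exact (congrArg k g2).trans k2
        · exact (congrArg k g3).trans k3
        · refine (congrArg k g4).trans ?_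
          rw [map_mul, map_mul, k3, k2]
          change _ = toLocR p q (X 4)
          linear_combination k u * hR2 + toLocR p q (X 4) * ku
        · exact (congrArg k g5).trans k4
        · exact (congrArg k g6).trans k5
        · refine (congrArg k g7).trans ?_
          rw [map_mul, map_mul, k5, k4]
          change _ = toLocR p q (X 7)
          linear_combination k u * hR1 + toLocR p q (X 7) * ku
    exact fun x => RingHom.congr_fun this x
  have hgk : g.comp k = RingHom.id _ := by
    apply extGen (tRels p q)
    have : (g.comp k).comp (toLocT p q) = (RingHom.id _).comp (toLocT p q) := by
      apply MvPolynomial.ringHom_ext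
      · intro c
        simp only [RingHom.comp_apply, RingHom.id_apply, gC, kC]
      · intro i
        simp only [RingHom.comp_apply, RingHom.id_apply]
        fin_cases i
        · exact (congrArg g k0).trans g0
        · exact (congrArg g k1).trans g1
        · exact (congrArg g k2).trans g2
        · exact (congrArg g k3).trans g3
        · exact (congrArg g k4).trans g5
        · exact (congrArg g k5).trans g6
    exact fun x => RingHom.congr_fun this x
  refine ⟨RingEquiv.ofRingHom g k hgk hkg, gC, g0, g1, g2, g3, g5, g6, ?_, ?_⟩
  · change g _ * _ = _
    rw [g4, map_sub, map_mul]
    linear_combination toLocT p q (X 3) * toLocT p q (X 2) * hu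
  · change g _ * _ = _
    rw [g7, map_sub, map_mul]
    linear_combination toLocT p q (X 5) * toLocT p q (X 4) * hu

end
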